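/- Let F be a face of σ^∨ and let p_F be the associated graded prime ideal of R. Then tr(ω) ⊆ p_F holds if and only if F[1] contains no lattice point, i.e. F[1] ∩ ℤ^n = ∅. -/

import Mathlib

set_option synthInstance.maxHeartbeats 1000000
set_option maxHeartbeats 1000000

noncomputable section

variable {α : Type} [Fintype α]

/-- pairing of an integer vector with a real vector -/
def ipair (u : α → ℤ) (x : α → ℝ) : ℝ := ∑ j, (u j : ℝ) * x j

/-- pairing of two integer vectors -/
def zpair (u m : α → ℤ) : ℤ := ∑ j, u j * m j

/-- pairing of two real vectors -/
def rpair (u x : α → ℝ) : ℝ := ∑ j, u j * x j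

/-- the real vector associated to an integer vector -/
def toReal (m : α → ℤ) : α → ℝ := fun j => (m j : ℝ)

variable {ι : Type} [Fintype ι]

/-- the cone `σ` generated by the integer vectors `u i` -/
def genCone (u : ι → α → ℤ) : Set (α → ℝ) :=
  {x | ∃ c : ι → ℝ, (∀ i, 0 ≤ c i) ∧ x = ∑ i, c i • toReal (u i)}

/-- the dual cone `σ^∨` of the cone generated by the `u i` -/
def dualCone (u : ι → α → ℤ) : Set (α → ℝ) := {x | ∀ i, 0 ≤ ipair (u i) x}

/-- the polyhedron `P_K` -/
def PK (u : ι → α → ℤ) : Set (α → ℝ) := {x | ∀ i, 1 ≤ ipair (u i) x}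

/-- the polyhedron `P_{-K}` -/
def PmK (u : ι → α → ℤ) : Set (α → ℝ) := {x | ∀ i, (-1 : ℝ) ≤ ipair (u i) x}

/-- the cone generated by `u` is pointed -/
def IsPointed (u : ι → α → ℤ) : Prop := ∀ x ∈ genCone u, -x ∈ genCone u → x = 0

/-- an integer vector is primitive if the gcd of its coordinates is a unit -/
def Primitive (m : α → ℤ) : Prop := IsUnit (Finset.univ.gcd m)

/-- the ray spanned by an integer vector -/
def ray (v : α → ℤ) : Set (α → ℝ) := {x | ∃ t : ℝ, 0 ≤ t ∧ x = t • toReal v}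

/-- `u` lists exactly the primitive ray generators of the rational pointed cone `σ` that it
generates: `σ` is pointed, each `u i` is primitive, and each `u i` spans an extreme ray of `σ`. -/
def IsRaySetup (u : ι → α → ℤ) : Prop :=
  IsPointed u ∧ (∀ i, Primitive (u i)) ∧ ∀ i, IsExtreme ℝ (genCone u) (ray (u i))

variable (k : Type) [Field k]

/-- the monomial `χ^m` in the Laurent polynomial ring `k[ℤ^α]` -/
def mono (m : α → ℤ) : AddMonoidAlgebra k (α → ℤ) := AddMonoidAlgebra.single m 1

/-- the toric ring `R = k[σ^∨ ∩ M]`, the subalgebra of `k[ℤ^α]` spanned by the monomials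
`χ^m` with `m ∈ σ^∨ ∩ M` -/
def toricRing (u : ι → α → ℤ) : Subalgebra k (AddMonoidAlgebra k (α → ℤ)) :=
  Algebra.adjoin k {f | ∃ m : α → ℤ, toReal m ∈ dualCone u ∧ f = mono k m}

/-- the canonical module `ω`, the `R`-submodule of `k[ℤ^α]` spanned by the monomials `χ^m`
with `m ∈ P_K ∩ M` -/
def canMod (u : ι → α → ℤ) : Submodule ↥(toricRing k u) (AddMonoidAlgebra k (α → ℤ)) :=
  Submodule.span ↥(toricRing k u) {f | ∃ m : α → ℤ, toReal m ∈ PK u ∧ f = mono k m}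

/-- the trace ideal `tr(ω)` of the canonical module -/
def traceIdeal (u : ι → α → ℤ) : Ideal ↥(toricRing k u) :=
  Ideal.span {r | ∃ (φ : ↥(canMod k u) →ₗ[↥(toricRing k u)] ↥(toricRing k u))
    (x : ↥(canMod k u)), φ x = r}

/-- a face `F` of the dual cone `σ^∨`: the intersection of `σ^∨` with the hyperplane orthogonal
to a supporting vector `w ∈ σ` -/
def IsFaceOfDual (u : ι → α → ℤ) (F : Set (α → ℝ)) : Prop :=
  ∃ w ∈ genCone u, F = {x ∈ dualCone u | rpair w x = 0}

/-- the graded prime ideal `p_F` associated to a face `F` of `σ^∨`, generated by the monomials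
`χ^m` with `m ∈ (σ^∨ ∩ M) \ F` -/
def facePrime (u : ι → α → ℤ) (F : Set (α → ℝ)) : Ideal ↥(toricRing k u) :=
  Ideal.span {r | ∃ m : α → ℤ, toReal m ∈ dualCone u ∧ toReal m ∉ F ∧
    (r : AddMonoidAlgebra k (α → ℤ)) = mono k m}

/-- `F[1]`: the intersection of all facet-defining hyperplanes containing `F`, translated by one
lattice length into the interior of `σ^∨` -/
def faceShift (u : ι → α → ℤ) (F : Set (α → ℝ)) : Set (α → ℝ) :=
  {x | ∀ i, (∀ y ∈ F, ipair (u i) y = 0) → ipair (u i) x = 1}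

end

section Lattice

variable {α ι : Type} [Fintype α]

theorem ipair_toReal (u m : α → ℤ) : ipair u (toReal m) = zpair u m := by
  simp [ipair, zpair, toReal]

theorem toReal_mem_dualCone {u : ι → α → ℤ} {m : α → ℤ} :
    toReal m ∈ dualCone u ↔ ∀ i, 0 ≤ zpair (u i) m := by
  simp only [dualCone, Set.mem_ofPred_eq, ipair_toReal]
  norm_cast

theorem toReal_mem_PK {u : ι → α → ℤ} {m : α → ℤ} :
    toReal m ∈ PK u ↔ ∀ i, 1 ≤ zpair (u i) m := by
  simp only [PK, Set.mem_ofPred_eq, ipair_toReal]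
  norm_cast

theorem zpair_add (u a b : α → ℤ) : zpair u (a + b) = zpair u a + zpair u b := by
  simp [zpair, mul_add, Finset.sum_add_distrib]

theorem zpair_neg (u a : α → ℤ) : zpair u (-a) = -zpair u a := by
  simp [zpair]

theorem zpair_zsmul (u a : α → ℤ) (t : ℤ) : zpair u (t • a) = t * zpair u a := by
  simp only [zpair, Pi.smul_apply, smul_eq_mul, Finset.mul_sum]
  exact Finset.sum_congr rfl fun _ _ => by ring

theorem ipair_sum {κ : Type} (u : α → ℤ) (s : Finset κ) (y : κ → α → ℝ) :
    ipair u (∑ a ∈ s, y a) = ∑ a ∈ s, ipair u (y a) := by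
  simp only [ipair, Finset.sum_apply, Finset.mul_sum]
  exact Finset.sum_comm

/-- A primitive vector pairs to one with some lattice vector. -/
theorem Primitive.exists_zpair_eq_one {v : α → ℤ} (hv : Primitive v) :
    ∃ m : α → ℤ, zpair v m = 1 := by
  obtain ⟨g, hg⟩ := Finset.gcd_eq_sum_mul Finset.univ v
  obtain ⟨e, he⟩ := hv.exists_right_inv
  refine ⟨e • g, ?_⟩
  rw [zpair_zsmul, zpair, ← hg, mul_comm, he]

/-- Finitely many positive reals remain positive under a suitable `ℚ`-linear functional. -/
theorem exists_rat_functional_pos {κ : Type} [Finite κ] (x : κ → ℝ) :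
    ∃ f : ℝ →ₗ[ℚ] ℚ, ∀ j, 0 < x j → 0 < f (x j) := by
  let B := Module.Basis.ofVectorSpace ℚ ℝ
  let g (r : ℝ) (t : Module.Basis.ofVectorSpaceIndex ℚ ℝ → ℝ) : ℝ :=
    ∑ l ∈ (B.repr r).support, (B.repr r l : ℝ) * t l
  have hg : ∀ r, Continuous (g r) := fun r => by fun_prop
  have hgB : ∀ r, g r B = r := fun r => by
    conv_rhs => rw [← B.linearCombination_repr r, Finsupp.linearCombination_apply, Finsupp.sum]
    exact Finset.sum_congr rfl fun l _ => (Rat.smul_def _ _).symm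
  have hopen : IsOpen {t | ∀ j, 0 < x j → 0 < g (x j) t} := by
    simp only [Set.ofPred_forall]
    exact isOpen_iInter_of_finite fun j => isOpen_iInter_of_finite fun _ =>
      isOpen_lt continuous_const (hg _)
  have hdense : DenseRange
      (Pi.map fun (_ : Module.Basis.ofVectorSpaceIndex ℚ ℝ) (q : ℚ) => (q : ℝ)) :=
    DenseRange.piMap fun _ => Rat.denseRange_cast
  obtain ⟨q, hq⟩ := hdense.exists_mem_open hopen ⟨B, fun j hj => by rwa [hgB]⟩
  refine ⟨B.constr ℚ q, fun j hj => ?_⟩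
  have h := hq j hj
  have h2 : g (x j) (Pi.map (fun _ (q : ℚ) => (q : ℝ)) q) = ((B.constr ℚ q (x j) : ℚ) : ℝ) := by
    simp [g, Module.Basis.constr_apply, Finsupp.sum, Pi.map]
  rw [h2] at h
  exact_mod_cast h

/-- A real vector pairing nonnegatively with finitely many integer vectors can be replaced by an
integer vector with the same vanishing and positivity pattern. -/
theorem exists_int_vector_of_real [Finite ι] (u : ι → α → ℤ) (y : α → ℝ) :
    ∃ m : α → ℤ, ∀ i, (ipair (u i) y = 0 → zpair (u i) m = 0) ∧
      (0 < ipair (u i) y → 0 < zpair (u i) m) := by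
  obtain ⟨f, hf⟩ := exists_rat_functional_pos fun i => ipair (u i) y
  obtain ⟨b, hb⟩ := IsLocalization.exist_integer_multiples_of_finite (nonZeroDivisors ℤ)
    fun a => f (y a)
  choose m hm using hb
  have hb0 : (b : ℤ) ≠ 0 := nonZeroDivisors.ne_zero b.2
  have key : ∀ i, ((zpair (u i) ((b : ℤ) • m) : ℤ) : ℚ) = (b : ℤ) ^ 2 * f (ipair (u i) y) := by
    intro i
    have hfi : f (ipair (u i) y) = ∑ a, (u i a : ℚ) * f (y a) := by
      rw [ipair, map_sum]
      refine Finset.sum_congr rfl fun a _ => ?_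
      rw [← zsmul_eq_mul, map_zsmul, zsmul_eq_mul]
    have hm' : ∀ a, (m a : ℚ) = (b : ℤ) * f (y a) := fun a => by
      simpa using hm a
    rw [hfi, zpair_zsmul, zpair]
    push_cast
    rw [sq, mul_assoc]
    congr 1
    rw [Finset.mul_sum]
    exact Finset.sum_congr rfl fun a _ => by rw [hm' a]; ring
  refine ⟨(b : ℤ) • m, fun i => ⟨fun h => ?_, fun h => ?_⟩⟩
  · have := key i
    rw [h, map_zero, mul_zero] at this
    exact_mod_cast this
  · have hpos := hf i h
    have : (0 : ℚ) < (b : ℤ) ^ 2 * f (ipair (u i) y) := by positivity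
    rw [← key i] at this
    exact_mod_cast this

theorem exists_abs_lt_mul [Fintype ι] (m g : ι → ℤ) :
    ∃ N : ℤ, ∀ i, 0 < g i → |m i| < N * g i := by
  have hN : 0 ≤ ∑ i, |m i| := Finset.sum_nonneg fun i _ => abs_nonneg _
  refine ⟨1 + ∑ i, |m i|, fun i hi => ?_⟩
  have h := Finset.single_le_sum (f := fun i => |m i|) (fun i _ => abs_nonneg _)
    (Finset.mem_univ i)
  nlinarith

end Lattice

section Cone

variable {α ι : Type} [Fintype ι]

theorem genCone_smul_mem {u : ι → α → ℤ} {x : α → ℝ} (hx : x ∈ genCone u) {t : ℝ}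
    (ht : 0 ≤ t) : t • x ∈ genCone u := by
  obtain ⟨c, hc, rfl⟩ := hx
  exact ⟨fun i => t * c i, fun i => mul_nonneg ht (hc i), by simp [Finset.smul_sum, smul_smul]⟩

theorem genCone_add_mem {u : ι → α → ℤ} {x y : α → ℝ} (hx : x ∈ genCone u)
    (hy : y ∈ genCone u) : x + y ∈ genCone u := by
  obtain ⟨c, hc, rfl⟩ := hx
  obtain ⟨d, hd, rfl⟩ := hy
  exact ⟨fun i => c i + d i, fun i => add_nonneg (hc i) (hd i),
    by simp [add_smul, Finset.sum_add_distrib]⟩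

theorem toReal_mem_genCone (u : ι → α → ℤ) (i : ι) : toReal (u i) ∈ genCone u := by
  classical
  exact ⟨Pi.single i 1, fun j => (Pi.single_nonneg.2 zero_le_one : (0 : ι → ℝ) ≤ Pi.single i 1) j,
    by simp [Pi.single_apply, ite_smul]⟩

variable [Fintype α]

theorem Primitive.toReal_ne_zero {v : α → ℤ} (hv : Primitive v) : toReal v ≠ 0 := by
  intro h
  obtain ⟨m, hm⟩ := hv.exists_zpair_eq_one
  have hv0 : v = 0 := funext fun a => by simpa [toReal] using congrFun h a
  simp [zpair, hv0] at hm

theorem Primitive.eq_of_mem_ray {v w : α → ℤ} (hv : Primitive v) (hw : Primitive w)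
    (h : toReal w ∈ ray v) : w = v := by
  obtain ⟨t, ht, hwt⟩ := h
  have hco : ∀ a, (w a : ℝ) = t * v a := fun a => congrFun hwt a
  have hpair : ∀ m, (zpair w m : ℝ) = t * zpair v m := fun m => by
    simp only [zpair, Int.cast_sum, Int.cast_mul, hco, Finset.mul_sum, mul_assoc]
  obtain ⟨p, hp⟩ := hv.exists_zpair_eq_one
  obtain ⟨q, hq⟩ := hw.exists_zpair_eq_one
  have h1 := hpair p
  have h2 := hpair q
  rw [hp, Int.cast_one, mul_one] at h1
  rw [hq, ← h1] at h2
  have h3 : (1 : ℤ) = zpair w p * zpair v q := by exact_mod_cast h2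
  have h4 : 0 ≤ zpair w p := by
    rw [← h1] at ht
    exact_mod_cast ht
  have h5 : zpair w p = 1 := Int.eq_one_of_mul_eq_one_right h4 h3.symm
  rw [h5, Int.cast_one] at h1
  funext a
  have := hco a
  rw [← h1, one_mul] at this
  exact_mod_cast this

/-- Gordan's alternative relative to a line: either some vector is orthogonal to `p` and pairs
positively with every `v j`, or a convex combination of the `v j` lies on the line through `p`. -/
theorem exists_pos_or_combination_mem_line {κ : Type} [Fintype κ] (p : α → ℝ)
    (v : κ → α → ℝ) :
    (∃ y : α → ℝ, rpair p y = 0 ∧ ∀ j, 0 < rpair (v j) y) ∨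
      ∃ c : κ → ℝ, c ∈ stdSimplex ℝ κ ∧ ∃ t : ℝ, ∑ j, c j • v j = t • p := by
  classical
  let L : (κ → ℝ) →ₗ[ℝ] (α → ℝ) := Fintype.linearCombination ℝ v
  have hL : ∀ c, L c = ∑ j, c j • v j := fun c => Fintype.linearCombination_apply ℝ v c
  by_cases hdis : Disjoint (L '' stdSimplex ℝ κ) (Submodule.span ℝ {p} : Set (α → ℝ))
  · left
    obtain ⟨f, a, b, ha, hab, hb⟩ := geometric_hahn_banach_compact_closed
      ((convex_stdSimplex ℝ κ).linear_image L)
      ((isCompact_stdSimplex ℝ κ).image L.continuous_of_finiteDimensional)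
      (Submodule.span ℝ {p}).convex (Submodule.closed_of_finiteDimensional _) hdis
    have hb0 : b < 0 := by simpa using hb 0 (Submodule.zero_mem _)
    have hfp : f p = 0 := by
      by_contra hne
      have := hb ((b / f p) • p) (Submodule.smul_mem _ _ (Submodule.mem_span_singleton_self p))
      rw [map_smul, smul_eq_mul, div_mul_cancel₀ _ hne] at this
      exact lt_irrefl _ this
    have hf : ∀ x : α → ℝ, rpair x (fun j => -f (Pi.single j 1)) = -f x := fun x => by
      conv_rhs => rw [← Finset.univ_sum_single x, map_sum]
      rw [rpair, ← Finset.sum_neg_distrib]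
      refine Finset.sum_congr rfl fun j _ => ?_
      have : (Pi.single j (x j) : α → ℝ) = x j • Pi.single j 1 := by
        rw [← Pi.single_smul, smul_eq_mul, mul_one]
      rw [this, map_smul, smul_eq_mul, mul_neg]
    refine ⟨fun j => -f (Pi.single j 1), by rw [hf, hfp, neg_zero], fun j => ?_⟩
    rw [hf]
    have := ha (v j) ⟨Pi.single j 1, single_mem_stdSimplex ℝ j, by
      simp [L, Fintype.linearCombination_apply_single]⟩
    linarith
  · right
    obtain ⟨x, ⟨c, hc, rfl⟩, hx⟩ := Set.not_disjoint_iff.1 hdis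
    obtain ⟨t, ht⟩ := Submodule.mem_span_singleton.1 hx
    exact ⟨c, hc, t, by rw [← hL, ht]⟩

/-- Each ray of `σ` is the set of generators orthogonal to some point of the dual cone. -/
theorem IsRaySetup.exists_facet_vector {u : ι → α → ℤ} (hu : IsRaySetup u) (i : ι) :
    ∃ y : α → ℝ, ipair (u i) y = 0 ∧ ∀ j, u j ≠ u i → 0 < ipair (u j) y := by
  classical
  obtain ⟨hpt, hprim, hext⟩ := hu
  rcases exists_pos_or_combination_mem_line (toReal (u i))
    (fun j : {j // u j ≠ u i} => toReal (u j)) with ⟨y, hy, hpos⟩ | ⟨c, ⟨hc0, hc1⟩, t, hct⟩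
  · exact ⟨y, hy, fun j hj => hpos ⟨j, hj⟩⟩
  · exfalso
    obtain ⟨j₀, hj₀⟩ : ∃ j, 0 < c j := by
      by_contra! h
      have : ∑ j, c j ≤ 0 := Finset.sum_nonpos fun j _ => h j
      linarith
    set x := c j₀ • toReal (u j₀) with hx
    set r := ∑ j ∈ Finset.univ.erase j₀, c j • toReal (u j) with hr
    have hxr : x + r = t • toReal (u i) := by
      rw [← hct, hx, hr, Finset.add_sum_erase _ (fun j => c j • toReal (u j)) (Finset.mem_univ j₀)]
    have hxmem : x ∈ genCone u := genCone_smul_mem (toReal_mem_genCone u _) (hc0 _)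
    have hrmem : r ∈ genCone u := by
      refine Finset.sum_induction _ (· ∈ genCone u) (fun _ _ => genCone_add_mem)
        ⟨0, by simp, by simp⟩ fun j _ => genCone_smul_mem (toReal_mem_genCone u _) (hc0 _)
    rcases le_or_gt t 0 with ht | ht
    · have hneg : -x ∈ genCone u := by
        have : -x = r + (-t) • toReal (u i) := by
          rw [neg_smul, ← hxr]
          abel
        rw [this]
        exact genCone_add_mem hrmem
          (genCone_smul_mem (toReal_mem_genCone u i) (neg_nonneg.2 ht))
      have hx0 := hpt x hxmem hneg
      rw [hx, smul_eq_zero] at hx0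
      exact hx0.elim hj₀.ne' (hprim _).toReal_ne_zero
    · have hseg : t • toReal (u i) ∈ openSegment ℝ ((2 : ℝ) • x) ((2 : ℝ) • r) := by
        refine ⟨1 / 2, 1 / 2, by norm_num, by norm_num, by norm_num, ?_⟩
        rw [smul_smul (1 / 2) 2 x, smul_smul (1 / 2) 2 r, ← hxr]
        norm_num
      obtain ⟨s, hs, hs'⟩ := (hext i).left_mem_of_mem_openSegment
        (genCone_smul_mem hxmem zero_le_two) (genCone_smul_mem hrmem zero_le_two)
        ⟨t, ht.le, rfl⟩ hseg
      refine j₀.2 ((hprim i).eq_of_mem_ray (hprim _) ⟨(2 * c j₀)⁻¹ * s, by positivity, ?_⟩)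
      rw [← smul_smul, ← hs', hx, smul_smul, smul_smul, mul_assoc,
        inv_mul_cancel₀ (by positivity), one_smul]

/-- Every facet inequality of `P_K` is attained at a lattice point of `P_K`. -/
theorem IsRaySetup.exists_mem_PK_zpair_eq_one {u : ι → α → ℤ} (hu : IsRaySetup u) (i : ι) :
    ∃ m : α → ℤ, toReal m ∈ PK u ∧ zpair (u i) m = 1 := by
  obtain ⟨y, hy0, hy⟩ := hu.exists_facet_vector i
  obtain ⟨g, hg⟩ := exists_int_vector_of_real u y
  obtain ⟨m, hm⟩ := (hu.2.1 i).exists_zpair_eq_one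
  obtain ⟨N, hN⟩ := exists_abs_lt_mul (fun j => zpair (u j) m) (fun j => zpair (u j) g)
  have hi : zpair (u i) (m + N • g) = 1 := by
    rw [zpair_add, zpair_zsmul, hm, (hg i).1 hy0, mul_zero, add_zero]
  refine ⟨m + N • g, toReal_mem_PK.2 fun j => ?_, hi⟩
  by_cases hj : u j = u i
  · rw [hj, hi]
  · have h1 := hN j ((hg j).2 (hy j hj))
    have h2 := neg_abs_le (zpair (u j) m)
    rw [zpair_add, zpair_zsmul]
    linarith

theorem rpair_sum_smul (u : ι → α → ℤ) (c : ι → ℝ) (x : α → ℝ) :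
    rpair (∑ i, c i • toReal (u i)) x = ∑ i, c i * ipair (u i) x := by
  simp only [rpair, ipair, toReal, Finset.sum_apply, Pi.smul_apply, smul_eq_mul, Finset.sum_mul,
    Finset.mul_sum]
  rw [Finset.sum_comm]
  exact Finset.sum_congr rfl fun _ _ => Finset.sum_congr rfl fun _ _ => by ring

theorem IsFaceOfDual.subset {u : ι → α → ℤ} {F : Set (α → ℝ)} (hF : IsFaceOfDual u F) :
    F ⊆ dualCone u := by
  obtain ⟨w, -, rfl⟩ := hF
  exact Set.sep_subset _ _

/-- A face of the dual cone is cut out by the generators vanishing on it. -/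
theorem IsFaceOfDual.mem_iff {u : ι → α → ℤ} {F : Set (α → ℝ)} (hF : IsFaceOfDual u F)
    {x : α → ℝ} :
    x ∈ F ↔ x ∈ dualCone u ∧ ∀ i, (∀ y ∈ F, ipair (u i) y = 0) → ipair (u i) x = 0 := by
  refine ⟨fun hx => ⟨hF.subset hx, fun i hi => hi x hx⟩, fun ⟨hx, hx0⟩ => ?_⟩
  obtain ⟨w, ⟨c, hc, rfl⟩, rfl⟩ := hF
  refine ⟨hx, ?_⟩
  rw [rpair_sum_smul]
  refine Finset.sum_eq_zero fun i _ => ?_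
  rcases (hc i).eq_or_lt with h | h
  · rw [← h, zero_mul]
  · rw [hx0 i, mul_zero]
    rintro y ⟨hy, hy0⟩
    rw [rpair_sum_smul, Finset.sum_eq_zero_iff_of_nonneg
      fun j _ => mul_nonneg (hc j) (hy j)] at hy0
    exact (mul_eq_zero.1 (hy0 i (Finset.mem_univ i))).resolve_left h.ne'

/-- A lattice point in the relative interior of a face of the dual cone. -/
theorem IsFaceOfDual.exists_relInterior_lattice_point {u : ι → α → ℤ} {F : Set (α → ℝ)}
    (hF : IsFaceOfDual u F) :
    ∃ f : α → ℤ, ∀ i, ((∀ y ∈ F, ipair (u i) y = 0) → zpair (u i) f = 0) ∧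
      (¬ (∀ y ∈ F, ipair (u i) y = 0) → 0 < zpair (u i) f) := by
  have hex : ∀ i, ∃ y : α → ℝ, y ∈ F ∧
      (¬ (∀ y ∈ F, ipair (u i) y = 0) → 0 < ipair (u i) y) := by
    intro i
    by_cases h : ∀ y ∈ F, ipair (u i) y = 0
    · exact ⟨0, hF.mem_iff.2 ⟨by simp [dualCone, ipair], by simp [ipair]⟩, fun h' => (h' h).elim⟩
    · push Not at h
      obtain ⟨y, hy, hy0⟩ := h
      exact ⟨y, hy, fun _ => lt_of_le_of_ne (hF.subset hy i) hy0.symm⟩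
  choose y hyF hypos using hex
  obtain ⟨f, hf⟩ := exists_int_vector_of_real u (∑ i, y i)
  refine ⟨f, fun i => ⟨fun h => (hf i).1 ?_, fun h => (hf i).2 ?_⟩⟩
  · rw [ipair_sum]
    exact Finset.sum_eq_zero fun j _ => h _ (hyF j)
  · rw [ipair_sum]
    exact Finset.sum_pos' (fun j _ => hF.subset (hyF j) i) ⟨i, Finset.mem_univ i, hypos i h⟩

end Cone

section Algebra

variable {α ι : Type} {k : Type} [Field k]

theorem mono_mul_mono (a b : α → ℤ) : mono k a * mono k b = mono k (a + b) := by
  simp [mono, AddMonoidAlgebra.single_mul_single]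

theorem coeff_mono_self (m : α → ℤ) : (mono k m).coeff m = 1 := by
  simp [mono]

theorem eq_of_coeff_mono_ne_zero {a s : α → ℤ} (h : (mono k a).coeff s ≠ 0) : s = a := by
  by_contra hne
  exact h (by simp [mono, Ne.symm hne])

theorem coeff_mono_mul (a s : α → ℤ) (f : AddMonoidAlgebra k (α → ℤ)) :
    (mono k a * f).coeff (a + s) = f.coeff s := by
  rw [mono, AddMonoidAlgebra.coeff_single_mul_eq_mul_coeff s (by simp), one_mul]

theorem exists_of_coeff_mul_ne_zero {f g : AddMonoidAlgebra k (α → ℤ)} {s : α → ℤ}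
    (h : (f * g).coeff s ≠ 0) : ∃ a b, f.coeff a ≠ 0 ∧ g.coeff b ≠ 0 ∧ a + b = s := by
  classical
  have := AddMonoidAlgebra.support_coeff_mul_subset f g (Finsupp.mem_support_iff.2 h)
  obtain ⟨a, ha, b, hb, rfl⟩ := Finset.mem_add.1 this
  exact ⟨a, b, Finsupp.mem_support_iff.1 ha, Finsupp.mem_support_iff.1 hb, rfl⟩

theorem sum_smul_mono (f : AddMonoidAlgebra k (α → ℤ)) :
    f = ∑ s ∈ f.coeff.support, f.coeff s • mono k s := by
  conv_lhs => rw [← AddMonoidAlgebra.sum_coeff_single f, Finsupp.sum]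
  exact Finset.sum_congr rfl fun s _ => by simp [mono, AddMonoidAlgebra.smul_single]

variable [Fintype α]

theorem mono_mem_toricRing {u : ι → α → ℤ} {m : α → ℤ} (hm : toReal m ∈ dualCone u) :
    mono k m ∈ toricRing k u :=
  Algebra.subset_adjoin ⟨m, hm, rfl⟩

/-- The toric ring consists of the Laurent polynomials supported in the dual cone. -/
theorem mem_toricRing_iff {u : ι → α → ℤ} {f : AddMonoidAlgebra k (α → ℤ)} :
    f ∈ toricRing k u ↔ ∀ s, f.coeff s ≠ 0 → toReal s ∈ dualCone u := by
  constructor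
  · intro hf
    induction hf using Algebra.adjoin_induction with
    | mem x hx =>
      obtain ⟨m, hm, rfl⟩ := hx
      exact fun s hs => eq_of_coeff_mono_ne_zero hs ▸ hm
    | algebraMap r =>
      intro s hs
      have : s = 0 := by
        by_contra hne
        exact hs (by simp [Ne.symm hne])
      subst this
      exact toReal_mem_dualCone.2 fun i => by simp [zpair]
    | add x y _ _ hx hy =>
      intro s hs
      by_cases h : x.coeff s = 0
      · exact hy s fun h' => hs (by simp [h, h'])
      · exact hx s h
    | mul x y _ _ hx hy =>
      intro s hs
      obtain ⟨a, b, ha, hb, rfl⟩ := exists_of_coeff_mul_ne_zero hs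
      refine toReal_mem_dualCone.2 fun i => ?_
      rw [zpair_add]
      exact add_nonneg (toReal_mem_dualCone.1 (hx a ha) i) (toReal_mem_dualCone.1 (hy b hb) i)
  · intro h
    rw [sum_smul_mono f]
    exact Subalgebra.sum_mem _ fun s hs =>
      Subalgebra.smul_mem _ (mono_mem_toricRing (h s (Finsupp.mem_support_iff.1 hs))) _

theorem mem_facePrime_of_support {u : ι → α → ℤ} {F : Set (α → ℝ)} {r : ↥(toricRing k u)}
    (h : ∀ s, (r : AddMonoidAlgebra k (α → ℤ)).coeff s ≠ 0 → toReal s ∉ F) :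
    r ∈ facePrime k u F := by
  have hr := mem_toricRing_iff.1 r.2
  have hsum : r = ∑ s ∈ (r : AddMonoidAlgebra k (α → ℤ)).coeff.support.attach,
      (r : AddMonoidAlgebra k (α → ℤ)).coeff s •
        (⟨mono k s, mono_mem_toricRing (hr s (Finsupp.mem_support_iff.1 s.2))⟩ :
          ↥(toricRing k u)) := by
    apply Subtype.ext
    conv_lhs => rw [sum_smul_mono (r : AddMonoidAlgebra k (α → ℤ))]
    rw [AddSubmonoidClass.coe_finsetSum, ← Finset.sum_attach]
    rfl
  rw [hsum]
  refine Submodule.sum_mem _ fun s _ => ?_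
  rw [Algebra.smul_def]
  refine Ideal.mul_mem_left _ _ (Ideal.subset_span ⟨s, ?_, ?_, rfl⟩)
  · exact hr s (Finsupp.mem_support_iff.1 s.2)
  · exact h s (Finsupp.mem_support_iff.1 s.2)

theorem support_of_mem_facePrime [Fintype ι] {u : ι → α → ℤ} {F : Set (α → ℝ)}
    (hF : IsFaceOfDual u F) {r : ↥(toricRing k u)} (hr : r ∈ facePrime k u F) :
    ∀ s, (r : AddMonoidAlgebra k (α → ℤ)).coeff s ≠ 0 → toReal s ∉ F := by
  induction hr using Submodule.span_induction with
  | mem x hx =>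
    obtain ⟨m, -, hmF, hm⟩ := hx
    intro s hs
    rw [hm] at hs
    exact eq_of_coeff_mono_ne_zero hs ▸ hmF
  | zero => exact fun s hs => (hs (by simp)).elim
  | add x y _ _ hx hy =>
    intro s hs
    by_cases h : (x : AddMonoidAlgebra k (α → ℤ)).coeff s = 0
    · exact hy s fun h' => hs (by simp [h, h'])
    · exact hx s h
  | smul a x _ hx =>
    intro s hs hsF
    obtain ⟨p, q, hp, hq, rfl⟩ := exists_of_coeff_mul_ne_zero hs
    have hpd := toReal_mem_dualCone.1 (mem_toricRing_iff.1 a.2 p hp)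
    have hqd := mem_toricRing_iff.1 x.2 q hq
    refine hx q hq (hF.mem_iff.2 ⟨hqd, fun i hi => ?_⟩)
    have h0 := hi _ hsF
    have hqi := toReal_mem_dualCone.1 hqd i
    have hpi := hpd i
    rw [ipair_toReal, zpair_add] at h0
    rw [ipair_toReal]
    norm_cast at h0 ⊢
    omega

theorem mono_mem_canMod {u : ι → α → ℤ} {m : α → ℤ} (hm : toReal m ∈ PK u) :
    mono k m ∈ canMod k u :=
  Submodule.subset_span ⟨m, hm, rfl⟩

theorem PK_subset_dualCone (u : ι → α → ℤ) : PK u ⊆ dualCone u :=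
  fun _ hx i => zero_le_one.trans (hx i)

/-- A homomorphism `ω → R` shifts the degree of `χ^a` only by elements of `P_{-K}`. -/
theorem neg_one_le_zpair_sub_of_hom [Fintype ι] {u : ι → α → ℤ} (hu : IsRaySetup u)
    (φ : ↥(canMod k u) →ₗ[↥(toricRing k u)] ↥(toricRing k u)) {a : α → ℤ}
    (ha : toReal a ∈ PK u) {s : α → ℤ}
    (hs : (φ ⟨mono k a, mono_mem_canMod ha⟩ : AddMonoidAlgebra k (α → ℤ)).coeff s ≠ 0) (i : ι) :
    -1 ≤ zpair (u i) s - zpair (u i) a := by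
  obtain ⟨b, hb, hbi⟩ := hu.exists_mem_PK_zpair_eq_one i
  have hswap : ∀ (x y : α → ℤ) (hx : toReal x ∈ PK u) (hy : toReal y ∈ PK u),
      mono k x * (φ ⟨mono k y, mono_mem_canMod hy⟩ : AddMonoidAlgebra k (α → ℤ)) =
        φ ((⟨mono k x, mono_mem_toricRing (PK_subset_dualCone u hx)⟩ : ↥(toricRing k u)) •
          ⟨mono k y, mono_mem_canMod hy⟩) := fun x y hx hy => by
    rw [map_smul]
    rfl
  have heq : mono k b * (φ ⟨mono k a, mono_mem_canMod ha⟩ : AddMonoidAlgebra k (α → ℤ)) =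
      mono k a * (φ ⟨mono k b, mono_mem_canMod hb⟩ : AddMonoidAlgebra k (α → ℤ)) := by
    rw [hswap b a hb ha, hswap a b ha hb]
    congr 2
    exact Subtype.ext (mul_comm (mono k b) (mono k a))
  rw [← coeff_mono_mul b s, heq, show b + s = a + (b + s - a) by abel, coeff_mono_mul] at hs
  have h := toReal_mem_dualCone.1 (mem_toricRing_iff.1 (Subtype.property _) _ hs) i
  rw [sub_eq_add_neg, zpair_add, zpair_add, zpair_neg, hbi] at h
  linarith

theorem mono_mul_mem_toricRing {u : ι → α → ℤ} {b : α → ℤ} (hb : ∀ i, -1 ≤ zpair (u i) b)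
    {x : AddMonoidAlgebra k (α → ℤ)} (hx : x ∈ canMod k u) : mono k b * x ∈ toricRing k u := by
  induction hx using Submodule.span_induction with
  | mem x hx =>
    obtain ⟨a, ha, rfl⟩ := hx
    rw [mono_mul_mono]
    refine mono_mem_toricRing (toReal_mem_dualCone.2 fun i => ?_)
    rw [zpair_add]
    linarith [hb i, toReal_mem_PK.1 ha i]
  | zero => simp
  | add x y _ _ hx hy =>
    rw [mul_add]
    exact add_mem hx hy
  | smul r x _ hx =>
    rw [mul_smul_comm]
    exact mul_mem r.2 hx

/-- Multiplication by `χ^b` as a homomorphism `ω → R`, for `b ∈ P_{-K} ∩ M`. -/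
noncomputable def mulMono {u : ι → α → ℤ} {b : α → ℤ} (hb : ∀ i, -1 ≤ zpair (u i) b) :
    ↥(canMod k u) →ₗ[↥(toricRing k u)] ↥(toricRing k u) where
  toFun x := ⟨mono k b * x, mono_mul_mem_toricRing hb x.2⟩
  map_add' _ _ := Subtype.ext (mul_add _ _ _)
  map_smul' r x := Subtype.ext (mul_smul_comm r (mono k b) (x : AddMonoidAlgebra k (α → ℤ)))

end Algebra

/-- For a face `F` of `σ^∨` with associated graded prime `p_F`, one has
`tr(ω) ⊆ p_F` if and only if `F[1]` contains no lattice point. -/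
theorem trace_le_facePrime_iff
    {n : ℕ} {ι : Type} [Fintype ι] (u : ι → Fin n → ℤ) (hu : IsRaySetup u)
    (k : Type) [Field k] [IsAlgClosed k] [CharZero k]
    (F : Set (Fin n → ℝ)) (hF : IsFaceOfDual u F) :
    traceIdeal k u ≤ facePrime k u F ↔ ¬ ∃ m : Fin n → ℤ, toReal m ∈ faceShift u F := by
  constructor
  · rintro h ⟨m, hm⟩
    obtain ⟨f, hf⟩ := hF.exists_relInterior_lattice_point
    obtain ⟨N, hN⟩ := exists_abs_lt_mul (fun j => zpair (u j) m) (fun j => zpair (u j) f)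
    have hm1 : ∀ i, (∀ y ∈ F, ipair (u i) y = 0) → zpair (u i) m = 1 := fun i hi => by
      have := hm i hi
      rw [ipair_toReal] at this
      exact_mod_cast this
    have hface : ∀ i, (∀ y ∈ F, ipair (u i) y = 0) ∧ N * zpair (u i) f = 0 ∧ zpair (u i) m = 1 ∨
        |zpair (u i) m| < N * zpair (u i) f := fun i => by
      by_cases hi : ∀ y ∈ F, ipair (u i) y = 0
      · exact Or.inl ⟨hi, by rw [(hf i).1 hi, mul_zero], hm1 i hi⟩
      · exact Or.inr (hN i ((hf i).2 hi))
    have ha : toReal (m + N • f) ∈ PK u := toReal_mem_PK.2 fun i => by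
      rw [zpair_add, zpair_zsmul]
      rcases hface i with h | h
      · omega
      · have := abs_lt.1 h
        omega
    have hb : ∀ i, -1 ≤ zpair (u i) (-m + N • f) := fun i => by
      rw [zpair_add, zpair_zsmul, zpair_neg]
      rcases hface i with h | h
      · omega
      · have := abs_lt.1 h
        omega
    have hmem := h (Ideal.subset_span
      ⟨mulMono (k := k) hb, ⟨mono k (m + N • f), mono_mem_canMod ha⟩, rfl⟩)
    refine support_of_mem_facePrime hF hmem ((-m + N • f) + (m + N • f)) ?_ ?_
    · change (mono k (-m + N • f) * mono k (m + N • f)).coeff _ ≠ 0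
      rw [mono_mul_mono, coeff_mono_self]
      exact one_ne_zero
    · have hz : ∀ i, zpair (u i) ((-m + N • f) + (m + N • f)) = 2 * (N * zpair (u i) f) :=
        fun i => by
          simp only [zpair_add, zpair_zsmul, zpair_neg]
          ring
      refine hF.mem_iff.2 ⟨toReal_mem_dualCone.2 fun i => ?_, fun i hi => ?_⟩
      · rw [hz]
        rcases hface i with h | h
        · omega
        · have := abs_nonneg (zpair (u i) m)
          omega
      · rw [ipair_toReal, hz, (hf i).1 hi]
        simp
  · intro h
    refine Ideal.span_le.2 ?_
    rintro _ ⟨φ, ⟨x, hx⟩, rfl⟩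
    change φ ⟨x, hx⟩ ∈ facePrime k u F
    induction hx using Submodule.span_induction with
    | mem x hx =>
      obtain ⟨a, ha, rfl⟩ := hx
      refine mem_facePrime_of_support fun s hs hsF => h ⟨a, fun i hi => ?_⟩
      have h1 := neg_one_le_zpair_sub_of_hom hu φ ha hs i
      have h2 := toReal_mem_PK.1 ha i
      have h3 := hi _ hsF
      rw [ipair_toReal] at h3 ⊢
      norm_cast at h3 ⊢
      omega
    | zero =>
      have : φ ⟨0, Submodule.zero_mem _⟩ = 0 := map_zero φ
      rw [this]
      exact Submodule.zero_mem _
    | add x y hx hy ihx ihy =>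
      have : φ ⟨x + y, Submodule.add_mem _ hx hy⟩ = φ ⟨x, hx⟩ + φ ⟨y, hy⟩ :=
        map_add φ ⟨x, hx⟩ ⟨y, hy⟩
      rw [this]
      exact Submodule.add_mem _ ihx ihy
    | smul r x hx ih =>
      have : φ ⟨r • x, Submodule.smul_mem _ r hx⟩ = r • φ ⟨x, hx⟩ := map_smul φ r ⟨x, hx⟩
      rw [this]
      exact Submodule.smul_mem _ r ih
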